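/- arXiv:2510.23484 — 2 statements merged into one kernel-verified Lean document; each statement's English description precedes it below -/
import Mathlib

section
/- Let r > 0 and let B be the closed Euclidean ball of radius r centered at the origin in ℝ^d. For any n with 2 ≤ n ≤ d+1 and any points z₁, …, zₙ ∈ B, the minimum spanning tree length satisfies E(MST({z₁,…,zₙ})) ≤ (n−1) · r · √(2n/(n−1)). -/
open scoped BigOperators

/-- The length of an edge `e` (an unordered pair of indices) with respect to
points `z` in Euclidean space: the Euclidean distance between its endpoints. -/
noncomputable def edgeLen {V : Type*} {d : ℕ} (z : V → EuclideanSpace ℝ (Fin d)) :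
    Sym2 V → ℝ :=
  Sym2.lift ⟨fun i j => dist (z i) (z j), fun i j => dist_comm (z i) (z j)⟩

/-- The total edge length of a graph `G` on the (finite) index set `V`,
with respect to points `z` in Euclidean space. -/
noncomputable def treeLength {V : Type*} [Finite V] {d : ℕ}
    (z : V → EuclideanSpace ℝ (Fin d)) (G : SimpleGraph V) : ℝ :=
  ∑ e ∈ (Set.toFinite G.edgeSet).toFinset, edgeLen z e

/-- The minimum spanning tree length of the points `z`: the infimum of the total
edge lengths of all spanning trees (connected acyclic simple graphs) on `V`. -/
noncomputable def mstLength {V : Type*} [Finite V] {d : ℕ}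
    (z : V → EuclideanSpace ℝ (Fin d)) : ℝ :=
  sInf (treeLength z '' {G : SimpleGraph V | G.IsTree})

open Finset in
/-- The length of the star centred at `c` is the sum of the distances to `c`. -/
lemma treeLength_starGraph {V : Type*} [Fintype V] [DecidableEq V] {d : ℕ}
    (z : V → EuclideanSpace ℝ (Fin d)) (c : V) :
    treeLength z (SimpleGraph.starGraph c) = ∑ j ∈ univ.erase c, dist (z c) (z j) := by
  have h : (Set.toFinite (SimpleGraph.starGraph c).edgeSet).toFinset =
      (univ.erase c).image fun j => s(c, j) := by
    ext e
    induction e with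
    | _ x y =>
      simp only [Set.Finite.mem_toFinset, SimpleGraph.mem_edgeSet, SimpleGraph.starGraph_adj,
        mem_image, mem_erase, mem_univ, and_true, Sym2.eq_iff]
      constructor
      · rintro ⟨hxy, rfl | rfl⟩
        · exact ⟨y, hxy.symm, .inl ⟨rfl, rfl⟩⟩
        · exact ⟨x, hxy, .inr ⟨rfl, rfl⟩⟩
      · rintro ⟨a, ha, ⟨rfl, rfl⟩ | ⟨rfl, rfl⟩⟩
        · exact ⟨ha.symm, .inl rfl⟩
        · exact ⟨ha, .inr rfl⟩
  rw [treeLength, h, sum_image fun a _ b _ hab => Sym2.congr_right.mp hab]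
  rfl

/-- The minimum spanning tree is at most as long as any spanning tree. -/
lemma mstLength_le_treeLength {V : Type*} [Finite V] {d : ℕ}
    (z : V → EuclideanSpace ℝ (Fin d)) {G : SimpleGraph V} (hG : G.IsTree) :
    mstLength z ≤ treeLength z G :=
  csInf_le ((Set.toFinite _).image _).bddBelow ⟨G, hG, rfl⟩

/-- The sum of squared distances over ordered pairs is `2n ∑ ‖zᵢ‖² - 2 ‖∑ zᵢ‖²`. -/
lemma sum_sum_dist_sq {V E : Type*} [Fintype V] [NormedAddCommGroup E] [InnerProductSpace ℝ E]
    (z : V → E) :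
    ∑ i, ∑ j, dist (z i) (z j) ^ 2 =
      2 * Fintype.card V * ∑ i, ‖z i‖ ^ 2 - 2 * ‖∑ i, z i‖ ^ 2 := by
  have h : ‖∑ i, z i‖ ^ 2 = ∑ i, ∑ j, inner ℝ (z i) (z j) := by
    simp only [← real_inner_self_eq_norm_sq, sum_inner, inner_sum]
    exact Finset.sum_comm
  simp only [h, dist_eq_norm, norm_sub_sq_real, Finset.sum_add_distrib, Finset.sum_sub_distrib,
    ← Finset.mul_sum, Finset.sum_const, Finset.card_univ, nsmul_eq_mul]
  ring

/-- For `n` points (with `2 ≤ n ≤ d+1`) in the closed ball of radius `r` centered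
at the origin in `ℝ^d`, the MST length is at most `(n-1)·r·√(2n/(n-1))`. -/
theorem mst_le_of_mem_ball {d n : ℕ} (hn : 2 ≤ n) (hnd : n ≤ d + 1)
    (r : ℝ) (hr : 0 < r)
    (z : Fin n → EuclideanSpace ℝ (Fin d))
    (hz : ∀ i, z i ∈ Metric.closedBall (0 : EuclideanSpace ℝ (Fin d)) r) :
    mstLength z ≤
      ((n : ℝ) - 1) * r * Real.sqrt (2 * (n : ℝ) / ((n : ℝ) - 1)) := by
  have hn' : (2 : ℝ) ≤ n := by exact_mod_cast hn
  have : NeZero n := ⟨by omega⟩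
  obtain ⟨c, -, hc⟩ : ∃ c ∈ Finset.univ,
      ∑ j, dist (z c) (z j) ^ 2 ≤ 2 * (n : ℝ) * r ^ 2 := by
    apply Finset.exists_le_of_sum_le Finset.univ_nonempty
    have hsq : ∑ i, ‖z i‖ ^ 2 ≤ ∑ _i : Fin n, r ^ 2 :=
      Finset.sum_le_sum fun i _ =>
        pow_le_pow_left₀ (norm_nonneg _) (mem_closedBall_zero_iff.mp (hz i)) 2
    simp only [Finset.sum_const, Finset.card_univ, Fintype.card_fin, nsmul_eq_mul] at hsq
    rw [sum_sum_dist_sq]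
    simp only [Finset.sum_const, Finset.card_univ, Fintype.card_fin, nsmul_eq_mul]
    have := mul_le_mul_of_nonneg_left hsq (by positivity : (0 : ℝ) ≤ 2 * n)
    linarith [sq_nonneg ‖∑ i, z i‖]
  refine (mstLength_le_treeLength z (SimpleGraph.isTree_starGraph c)).trans ?_
  rw [treeLength_starGraph]
  have h1 : (0 : ℝ) < n - 1 := by linarith
  refine le_of_pow_le_pow_left₀ two_ne_zero (by positivity) ?_
  have hcard : ((Finset.univ.erase c).card : ℝ) = n - 1 := by
    simp [Finset.card_erase_of_mem, Nat.cast_sub (by omega : 1 ≤ n)]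
  calc (∑ j ∈ Finset.univ.erase c, dist (z c) (z j)) ^ 2
      ≤ (n - 1) * ∑ j ∈ Finset.univ.erase c, dist (z c) (z j) ^ 2 := by
        rw [← hcard]; exact sq_sum_le_card_mul_sum_sq
    _ ≤ (n - 1) * (2 * n * r ^ 2) := by
        gcongr
        exact (Finset.sum_le_univ_sum_of_nonneg fun _ => sq_nonneg _).trans hc
    _ = ((n - 1) * r * √(2 * n / (n - 1))) ^ 2 := by
        rw [mul_pow, Real.sq_sqrt (by positivity)]
        field_simp
end

section
/- (Instance cloning constraint.) For any points z₁, …, zₙ ∈ ℝ^d, the minimum spanning tree length of the duplicated tuple (z₁, …, zₙ, z₁, …, zₙ) of 2n points equals the minimum spanning tree length of (z₁, …, zₙ): E(MST((z₁,…,zₙ,z₁,…,zₙ))) = E(MST((z₁,…,zₙ))). -/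
open scoped BigOperators

theorem edgeLen_nonneg {V : Type*} {d : ℕ} (z : V → EuclideanSpace ℝ (Fin d)) (e : Sym2 V) :
    0 ≤ edgeLen z e := by
  induction e using Sym2.ind with
  | _ u v => exact dist_nonneg (x := z u) (y := z v)

theorem edgeLen_comp {V W : Type*} {d : ℕ} (f : V → W) (z : W → EuclideanSpace ℝ (Fin d))
    (e : Sym2 V) : edgeLen (z ∘ f) e = edgeLen z (e.map f) := by
  induction e using Sym2.ind with
  | _ u v => rfl

theorem sum_edgeLen_image_le {V W : Type*} [DecidableEq (Sym2 W)] {d : ℕ} (f : V → W)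
    (z : W → EuclideanSpace ℝ (Fin d)) (S : Finset (Sym2 V)) :
    ∑ e ∈ S.image (Sym2.map f), edgeLen z e ≤ ∑ e ∈ S, edgeLen (z ∘ f) e := by
  simp only [edgeLen_comp]
  exact Finset.sum_image_le_of_nonneg fun e _ => edgeLen_nonneg z e

theorem SimpleGraph.Reachable.of_adj_imp_reachable {V W : Type*} {G : SimpleGraph V}
    {H : SimpleGraph W} {f : V → W} (h : ∀ u v, G.Adj u v → H.Reachable (f u) (f v))
    {u v : V} (huv : G.Reachable u v) : H.Reachable (f u) (f v) := by
  obtain ⟨p⟩ := huv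
  induction p with
  | nil => exact .refl _
  | cons hadj _ ih => exact (h _ _ hadj).trans ih

theorem SimpleGraph.reachable_fromEdgeSet {V : Type*} {s : Set (Sym2 V)} {u v : V}
    (h : s(u, v) ∈ s) : (SimpleGraph.fromEdgeSet s).Reachable u v := by
  by_cases huv : u = v
  · exact huv ▸ .refl _
  · exact SimpleGraph.Adj.reachable ((SimpleGraph.fromEdgeSet_adj s).2 ⟨h, huv⟩)

theorem mstLength_le_sum_of_connected {V : Type*} [Finite V] {d : ℕ}
    (z : V → EuclideanSpace ℝ (Fin d)) (S : Finset (Sym2 V))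
    (hS : (SimpleGraph.fromEdgeSet (S : Set (Sym2 V))).Connected) :
    mstLength z ≤ ∑ e ∈ S, edgeLen z e := by
  obtain ⟨T, hle, hT⟩ := hS.exists_isTree_le
  have hbdd : BddBelow (treeLength z '' {G : SimpleGraph V | G.IsTree}) := by
    refine ⟨0, ?_⟩
    rintro _ ⟨G, -, rfl⟩
    exact Finset.sum_nonneg fun e _ => edgeLen_nonneg z e
  refine (csInf_le hbdd ⟨T, hT, rfl⟩).trans
    (Finset.sum_le_sum_of_subset_of_nonneg (fun e he => ?_) fun e _ _ => edgeLen_nonneg z e)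
  have he' := SimpleGraph.edgeSet_mono hle ((Set.Finite.mem_toFinset _).1 he)
  rw [SimpleGraph.edgeSet_fromEdgeSet] at he'
  exact he'.1

theorem le_mstLength {V : Type*} [Finite V] [Nonempty V] {d : ℕ}
    {z : V → EuclideanSpace ℝ (Fin d)} {a : ℝ}
    (h : ∀ T : SimpleGraph V, T.IsTree → a ≤ treeLength z T) : a ≤ mstLength z := by
  obtain ⟨T, -, hT⟩ := (SimpleGraph.connected_top (V := V)).exists_isTree_le
  refine le_csInf ⟨_, T, hT, rfl⟩ ?_
  rintro _ ⟨G, hG, rfl⟩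
  exact h G hG

theorem mstLength_of_isEmpty {V : Type*} [Finite V] [IsEmpty V] {d : ℕ}
    (z : V → EuclideanSpace ℝ (Fin d)) : mstLength z = 0 := by
  have h : {G : SimpleGraph V | G.IsTree} = ∅ :=
    Set.eq_empty_of_forall_notMem fun G hG => not_isEmpty_of_nonempty V (h := hG.1.nonempty) ‹_›
  rw [mstLength, h, Set.image_empty, Real.sInf_empty]

/-- Repeating points does not change the minimum spanning tree length. -/
theorem mstLength_comp_of_surjective {V W : Type*} [Finite V] [Finite W] {d : ℕ} {f : V → W}
    (hf : Function.Surjective f) (z : W → EuclideanSpace ℝ (Fin d)) :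
    mstLength (z ∘ f) = mstLength z := by
  classical
  cases isEmpty_or_nonempty W with
  | inl hW =>
    have := Function.isEmpty f
    rw [mstLength_of_isEmpty, mstLength_of_isEmpty]
  | inr hW =>
    obtain ⟨s, hs⟩ := hf.hasRightInverse
    have : Nonempty V := hW.map s
    refine le_antisymm (le_mstLength fun T hT => ?_) (le_mstLength fun T hT => ?_)
    · have := Fintype.ofFinite V
      let A := (Set.toFinite T.edgeSet).toFinset.image (Sym2.map s)
      let B := Finset.univ.image fun v => s(v, s (f v))
      have hB : ∑ e ∈ B, edgeLen (z ∘ f) e = 0 := by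
        refine Finset.sum_eq_zero fun e he => ?_
        obtain ⟨v, -, rfl⟩ := Finset.mem_image.1 he
        simp [edgeLen, hs (f v)]
      have hA : ∑ e ∈ A, edgeLen (z ∘ f) e ≤ treeLength z T := by
        have h := sum_edgeLen_image_le s (z ∘ f) (Set.toFinite T.edgeSet).toFinset
        rwa [Function.comp_assoc, hs.comp_eq_id, Function.comp_id] at h
      have hconn : (SimpleGraph.fromEdgeSet ((A ∪ B : Finset _) : Set (Sym2 V))).Connected := by
        have hclone (v : V) : (SimpleGraph.fromEdgeSet
            ((A ∪ B : Finset _) : Set (Sym2 V))).Reachable v (s (f v)) :=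
          SimpleGraph.reachable_fromEdgeSet (Finset.mem_union_right _
            (Finset.mem_image_of_mem _ (Finset.mem_univ v)))
        refine ⟨fun u v => (hclone u).trans (.trans ?_ (hclone v).symm)⟩
        refine (hT.1.preconnected (f u) (f v)).of_adj_imp_reachable fun a b hab =>
          SimpleGraph.reachable_fromEdgeSet ?_
        exact Finset.mem_union_left _
          (Finset.mem_image.2 ⟨s(a, b), by simpa using hab, rfl⟩)
      calc mstLength (z ∘ f) ≤ ∑ e ∈ A ∪ B, edgeLen (z ∘ f) e :=
            mstLength_le_sum_of_connected _ _ hconn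
        _ ≤ ∑ e ∈ A ∪ B, edgeLen (z ∘ f) e + ∑ e ∈ A ∩ B, edgeLen (z ∘ f) e :=
            le_add_of_nonneg_right (Finset.sum_nonneg fun e _ => edgeLen_nonneg _ e)
        _ = ∑ e ∈ A, edgeLen (z ∘ f) e + ∑ e ∈ B, edgeLen (z ∘ f) e :=
            Finset.sum_union_inter
        _ ≤ treeLength z T := by rwa [hB, add_zero]
    · refine (mstLength_le_sum_of_connected z
        ((Set.toFinite T.edgeSet).toFinset.image (Sym2.map f)) ⟨fun a b => ?_⟩).trans
        (sum_edgeLen_image_le f z _)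
      obtain ⟨u, rfl⟩ := hf a
      obtain ⟨v, rfl⟩ := hf b
      refine (hT.1.preconnected u v).of_adj_imp_reachable fun u v huv =>
        SimpleGraph.reachable_fromEdgeSet ?_
      exact Finset.mem_image.2 ⟨s(u, v), by simpa using huv, rfl⟩

/-- Instance cloning constraint: duplicating every point (each clone treated as a
distinct vertex, giving `n + n` points) leaves the MST length unchanged. -/
theorem mstLength_instance_cloning {d n : ℕ}
    (z : Fin n → EuclideanSpace ℝ (Fin d)) :
    mstLength (Fin.append z z) = mstLength z := by
  have hf : Function.Surjective (Fin.append id id : Fin (n + n) → Fin n) :=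
    fun i => ⟨Fin.castAdd n i, Fin.append_left id id i⟩
  have hz : Fin.append z z = z ∘ Fin.append id id := by
    ext1 i
    refine Fin.addCases (fun j => ?_) (fun j => ?_) i
    · simp only [Fin.append_left, Function.comp_apply, id]
    · simp only [Fin.append_right, Function.comp_apply, id]
  rw [hz, mstLength_comp_of_surjective hf]
end
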